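/- arXiv:1109.0342 — 2 statements merged into one kernel-verified Lean document; each statement's English description precedes it below -/
import Mathlib

section
/- Let 0 ≤ 2f ≤ n. Then in A one has Ê_f · D̂_{(1^{2f},n−2f)} = (1 + qr⁻¹)^f · Ê_f · D̂_{(2^f,n−2f)}, where (1^{2f},n−2f) denotes the composition with 2f parts equal to 1 followed by n−2f, and (2^f,n−2f) the composition with f parts equal to 2 followed by n−2f. (This is the in-algebra form, obtained by closing off the top, of the identity ê_f D̂_{(1^{2f},n−2f)} = (1+qr⁻¹)^f ê_f D̂_{(2^f,n−2f)} for the bottom half-diagram ê_f of Ê_f.) -/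
open Finset
open scoped Pointwise

namespace BMWPaper

/-- The Coxeter length of a permutation of `Fin n`: the number of inversions. -/
def len {n : ℕ} (w : Equiv.Perm (Fin n)) : ℕ :=
  (Finset.univ.filter (fun p : Fin n × Fin n => p.1 < p.2 ∧ w p.2 < w p.1)).card

/-- `sGen n i` is the adjacent transposition `s_i = (i, i+1)` (1-based) in `S_n`;
it is the identity for out-of-range `i`. -/
def sGen (n i : ℕ) : Equiv.Perm (Fin n) :=
  if h : 1 ≤ i ∧ i < n then Equiv.swap ⟨i - 1, by omega⟩ ⟨i, h.2⟩ else 1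

/-- `pimg d i` is the (1-based) image `(i)d` of the point `i ∈ {1,…,n}` under the
*right* action of the permutation `d` (permutations act on points on the right,
so that `(a)(στ) = ((a)σ)τ` for the group multiplication `σ * τ`);
the junk value `0` is returned for out-of-range `i`. -/
def pimg {n : ℕ} (d : Equiv.Perm (Fin n)) (i : ℕ) : ℕ :=
  if h : i - 1 < n then ((d⁻¹ ⟨i - 1, h⟩ : Fin n) : ℕ) + 1 else 0

open scoped Classical in
/-- `Hset n f` is the set `H_f(n)` of all `d ∈ S_n` such that
`(1)d < (3)d < ⋯ < (2f-1)d`, `(2i-1)d < (2i)d` for `i = 1,…,f`, and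
`(2f+1)d < (2f+2)d < ⋯ < (n)d`. -/
noncomputable def Hset (n f : ℕ) : Finset (Equiv.Perm (Fin n)) :=
  Finset.univ.filter (fun d =>
    (∀ i ∈ Finset.Icc 1 (f - 1), pimg d (2 * i - 1) < pimg d (2 * i + 1)) ∧
    (∀ i ∈ Finset.Icc 1 f, pimg d (2 * i - 1) < pimg d (2 * i)) ∧
    (∀ j ∈ Finset.Icc (2 * f + 1) (n - 1), pimg d j < pimg d (j + 1)))

/-- The index of the block of the composition `μ` containing the (0-based) point `k`. -/
def blockOf (μ : List ℕ) (k : ℕ) : ℕ :=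
  ((List.range μ.length).filter (fun j => (μ.take (j + 1)).sum ≤ k)).length

open scoped Classical in
/-- The Young subgroup `S_μ` of `S_n` associated with a composition `μ` of `n`,
as the set of permutations preserving each of the consecutive blocks of `μ`. -/
noncomputable def youngSet (n : ℕ) (μ : List ℕ) : Finset (Equiv.Perm (Fin n)) :=
  Finset.univ.filter (fun w => ∀ a : Fin n, blockOf μ ((w a : ℕ)) = blockOf μ (a : ℕ))

open scoped Classical in
/-- The set `D_μ` of minimal-length right coset representatives of `S_μ` in `S_n`:
the elements of minimal length in their right coset `S_μ d`. -/
noncomputable def Dset (n : ℕ) (μ : List ℕ) : Finset (Equiv.Perm (Fin n)) :=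
  Finset.univ.filter (fun d => ∀ u ∈ youngSet n μ, len d ≤ len (u * d))

/-- The identification of `Fin m` with the block `[k, k+m)` of `Fin n` (0-based). -/
def shiftEquiv (n k m : ℕ) (h : k + m ≤ n) :
    Fin m ≃ {a : Fin n // k ≤ (a : ℕ) ∧ (a : ℕ) < k + m} where
  toFun b := ⟨⟨k + (b : ℕ), by have := b.isLt; omega⟩, by
    constructor
    · exact Nat.le_add_right _ _
    · have := b.isLt; simp only [Fin.val_mk]; omega⟩
  invFun a := ⟨(a : Fin n) - k, by have := a.2; omega⟩
  left_inv b := by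
    apply Fin.ext
    simp
  right_inv a := by
    apply Subtype.ext
    apply Fin.ext
    have := a.2
    simp only []
    omega

open scoped Classical in
/-- The embedding of `S_m` into `S_n` as the group of permutations of the
(1-based) block `{k+1, …, k+m}` of `{1, …, n}`. -/
noncomputable def shiftEmb (n k m : ℕ) (w : Equiv.Perm (Fin m)) : Equiv.Perm (Fin n) :=
  if h : k + m ≤ n then w.extendDomain (shiftEquiv n k m h) else 1

open scoped Classical in
/-- The subgroup of `S_n` of permutations fixing the (1-based) points `1, …, k`. -/
noncomputable def fixSet (n k : ℕ) : Finset (Equiv.Perm (Fin n)) :=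
  Finset.univ.filter (fun w => ∀ a : Fin n, (a : ℕ) < k → w a = a)


/-- `bbs n i` is the permutation `𝕤_i = s_{2i} s_{2i-1} s_{2i+1} s_{2i} = (2i-1, 2i+1)(2i, 2i+2)`. -/
def bbs (n i : ℕ) : Equiv.Perm (Fin n) :=
  sGen n (2 * i) * sGen n (2 * i - 1) * sGen n (2 * i + 1) * sGen n (2 * i)

open scoped Classical in
/-- The set `𝔻_{(1,f-1)} = {𝕤_1 𝕤_2 ⋯ 𝕤_k : k = 0, …, f-1}` in `S_{2f}`. -/
noncomputable def bbD1 (f : ℕ) : Finset (Equiv.Perm (Fin (2 * f))) :=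
  (Finset.range f).image (fun k => ((List.range k).map (fun j => bbs (2 * f) (j + 1))).prod)

open scoped Classical in
/-- The set `𝔻_{(1,f-2)}^{{2,…,f}} = {𝕤_2 𝕤_3 ⋯ 𝕤_k : k = 1, …, f-1}` in `S_{2f}`. -/
noncomputable def bbD1' (f : ℕ) : Finset (Equiv.Perm (Fin (2 * f))) :=
  (Finset.Icc 1 (f - 1)).image
    (fun k => ((List.range (k - 1)).map (fun j => bbs (2 * f) (j + 2))).prod)

open scoped Classical in
/-- `H_f^{(a)} = {d ∈ H_f(n) : (1)d⁻¹ = 1, (2)d⁻¹ = 2}`. -/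
noncomputable def HsetA (n f : ℕ) : Finset (Equiv.Perm (Fin n)) :=
  (Hset n f).filter (fun d => pimg d⁻¹ 1 = 1 ∧ pimg d⁻¹ 2 = 2)

open scoped Classical in
/-- `H_f^{(b)} = {d ∈ H_f(n) : (1)d⁻¹ = 1, (2)d⁻¹ = 3}`. -/
noncomputable def HsetB (n f : ℕ) : Finset (Equiv.Perm (Fin n)) :=
  (Hset n f).filter (fun d => pimg d⁻¹ 1 = 1 ∧ pimg d⁻¹ 2 = 3)

open scoped Classical in
/-- `H_f^{(c)} = {d ∈ H_f(n) : (1)d⁻¹ = 1, (2)d⁻¹ = 2f+1}`. -/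
noncomputable def HsetC (n f : ℕ) : Finset (Equiv.Perm (Fin n)) :=
  (Hset n f).filter (fun d => pimg d⁻¹ 1 = 1 ∧ pimg d⁻¹ 2 = 2 * f + 1)

open scoped Classical in
/-- `H_f^{(d)} = {d ∈ H_f(n) : (1)d⁻¹ = 2f+1, (2)d⁻¹ = 1}`. -/
noncomputable def HsetD (n f : ℕ) : Finset (Equiv.Perm (Fin n)) :=
  (Hset n f).filter (fun d => pimg d⁻¹ 1 = 2 * f + 1 ∧ pimg d⁻¹ 2 = 1)

open scoped Classical in
/-- `H_f^{(e)} = {d ∈ H_f(n) : (1)d⁻¹ = 2f+1, (2)d⁻¹ = 2f+2}`. -/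
noncomputable def HsetE (n f : ℕ) : Finset (Equiv.Perm (Fin n)) :=
  (Hset n f).filter (fun d => pimg d⁻¹ 1 = 2 * f + 1 ∧ pimg d⁻¹ 2 = 2 * f + 2)

section Algebra

variable {F : Type*} [Field F] {A : Type*} [Ring A] [Algebra F A]

/-- For a set `S` of permutations, `hat c Tw S = Σ_{w ∈ S} c^{ℓ(w)} T_w`. -/
noncomputable def hat {n : ℕ} (c : F) (Tw : Equiv.Perm (Fin n) → A)
    (S : Finset (Equiv.Perm (Fin n))) : A :=
  ∑ w ∈ S, c ^ len w • Tw w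

/-- `Ehat E f = E_1 E_3 ⋯ E_{2f-1}`. -/
def Ehat (E : ℕ → A) (f : ℕ) : A := ((List.range f).map (fun i => E (2 * i + 1))).prod

/-- `Tprod T a b = T_a T_{a+1} ⋯ T_b` (the empty product `1` if `b < a`). -/
def Tprod (T : ℕ → A) (a b : ℕ) : A := ((List.range (b + 1 - a)).map (fun t => T (a + t))).prod

/-- `sDesc n a b = s_a s_{a-1} ⋯ s_b` (descending product of adjacent transpositions). -/
def sDesc (n a b : ℕ) : Equiv.Perm (Fin n) :=
  ((List.range (a + 1 - b)).map (fun j => sGen n (a - j))).prod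

/-- The data of a Birman–Murakami–Wenzl algebra structure: an `F`-algebra `A`
with invertible elements `T_1, …, T_{n-1}` and elements `E_1, …, E_{n-1}`
satisfying the BMW relations, together with a map `w ↦ T_w` from `S_n` to `A`
with `T_id = 1`, `T_{s_i} = T_i` and `T_{uv} = T_u T_v` whenever lengths add. -/
structure BMWData (F : Type*) [Field F] (A : Type*) [Ring A] [Algebra F A]
    (n : ℕ) (q r : F) where
  T : ℕ → A
  Tinv : ℕ → A
  E : ℕ → A
  Tw : Equiv.Perm (Fin n) → A
  hq : q ≠ 0
  hr : r ≠ 0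
  hqq : q - q⁻¹ ≠ 0
  T_mul_Tinv : ∀ i, 1 ≤ i → i ≤ n - 1 → T i * Tinv i = 1
  Tinv_mul_T : ∀ i, 1 ≤ i → i ≤ n - 1 → Tinv i * T i = 1
  skein : ∀ i, 1 ≤ i → i ≤ n - 1 → T i - Tinv i = (q - q⁻¹) • (1 - E i)
  Esq : ∀ i, 1 ≤ i → i ≤ n - 1 → E i * E i = (1 + (r - r⁻¹) / (q - q⁻¹)) • E i
  braid : ∀ i, 1 ≤ i → i + 1 ≤ n - 1 → T i * T (i + 1) * T i = T (i + 1) * T i * T (i + 1)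
  T_comm : ∀ i j, 1 ≤ i → i ≤ n - 1 → 1 ≤ j → j ≤ n - 1 → (i + 1 < j ∨ j + 1 < i) →
    T i * T j = T j * T i
  EEE₁ : ∀ i, 1 ≤ i → i + 1 ≤ n - 1 → E i * E (i + 1) * E i = E i
  EEE₂ : ∀ i, 1 ≤ i → i + 1 ≤ n - 1 → E (i + 1) * E i * E (i + 1) = E (i + 1)
  TTE₁ : ∀ i, 1 ≤ i → i + 1 ≤ n - 1 → T i * T (i + 1) * E i = E (i + 1) * E i
  TTE₂ : ∀ i, 1 ≤ i → i + 1 ≤ n - 1 → T (i + 1) * T i * E (i + 1) = E i * E (i + 1)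
  ET : ∀ i, 1 ≤ i → i ≤ n - 1 → E i * T i = r⁻¹ • E i
  TE : ∀ i, 1 ≤ i → i ≤ n - 1 → T i * E i = r⁻¹ • E i
  ETE₁ : ∀ i, 1 ≤ i → i + 1 ≤ n - 1 → E i * T (i + 1) * E i = r • E i
  ETE₂ : ∀ i, 1 ≤ i → i + 1 ≤ n - 1 → E (i + 1) * T i * E (i + 1) = r • E (i + 1)
  Tw_one : Tw 1 = 1
  Tw_s : ∀ i, 1 ≤ i → i ≤ n - 1 → Tw (sGen n i) = T i
  Tw_mul : ∀ u v : Equiv.Perm (Fin n), len (u * v) = len u + len v →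
    Tw (u * v) = Tw u * Tw v

/-- The scalars `a_f` defined by `a_0 = 1` and `a_i = a_{i-1} · Σ_{k=0}^{i-1} q^{2k}`. -/
noncomputable def aseq (q : F) : ℕ → F
  | 0 => 1
  | (i + 1) => aseq q i * (∑ k ∈ Finset.range (i + 1), q ^ (2 * k))


/-- The scalars `c_f` defined by `c_0 = 1` and
`c_f = -((q^{4f-3} - q^{2f-3})/(r q^{2n-2f-2} - q⁻¹)) · c_{f-1}`. -/
noncomputable def cseq (q r : F) (n : ℕ) : ℕ → F
  | 0 => 1
  | (f + 1) =>
      -((q ^ (4 * ((f : ℤ) + 1) - 3) - q ^ (2 * ((f : ℤ) + 1) - 3)) /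
          (r * q ^ (2 * (n : ℤ) - 2 * ((f : ℤ) + 1) - 2) - q⁻¹)) * cseq q r n f

/-- The scalars `č_f` defined by `č_0 = 1` and
`č_f = (q^{3-4f}(1 - q^{2f})/(q + r q^{2+2f-2n})) · č_{f-1}` (with integer exponents). -/
noncomputable def ccseq (q r : F) (n : ℕ) : ℕ → F
  | 0 => 1
  | (f + 1) =>
      (q ^ ((3 : ℤ) - 4 * ((f : ℤ) + 1)) * (1 - q ^ (2 * (f + 1))) /
          (q + r * q ^ ((2 : ℤ) + 2 * ((f : ℤ) + 1) - 2 * (n : ℤ)))) * ccseq q r n f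

/-- The element `x_f = (H_f⁻¹)^ · Ŝ_{{2f+1,…,n}} · Ê_f · Ĥ_f` of the BMW algebra. -/
noncomputable def xEl {F : Type*} [Field F] {A : Type*} [Ring A] [Algebra F A]
    {n : ℕ} {q r : F} (D : BMWData F A n q r) (f : ℕ) : A :=
  hat q D.Tw ((Hset n f).image (fun d => d⁻¹)) * hat q D.Tw (fixSet n (2 * f)) *
    Ehat D.E f * hat q D.Tw (Hset n f)

/-- The element `x̌_f = (H_f⁻¹)ˇ · Š_{{2f+1,…,n}} · Ê_f · Ȟ_f` of the BMW algebra,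
where `ˇ` is formed with `-q⁻¹` in place of `q`. -/
noncomputable def xElCheck {F : Type*} [Field F] {A : Type*} [Ring A] [Algebra F A]
    {n : ℕ} {q r : F} (D : BMWData F A n q r) (f : ℕ) : A :=
  hat (-q⁻¹) D.Tw ((Hset n f).image (fun d => d⁻¹)) * hat (-q⁻¹) D.Tw (fixSet n (2 * f)) *
    Ehat D.E f * hat (-q⁻¹) D.Tw (Hset n f)

end Algebra

theorem swap_lt_swap_iff {n : ℕ} {a b : Fin n} (hab : (b : ℕ) = a + 1) {x y : Fin n}
    (h : ¬(x = a ∧ y = b)) (h' : ¬(x = b ∧ y = a)) :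
    Equiv.swap a b y < Equiv.swap a b x ↔ y < x := by
  simp only [Equiv.swap_apply_def]
  split_ifs <;> simp only [Fin.ext_iff, Fin.lt_def] at * <;> omega

/-- Left multiplication by an adjacent transposition that creates an inversion. -/
theorem len_swap_mul {n : ℕ} {a b : Fin n} (hab : (b : ℕ) = a + 1) {d : Equiv.Perm (Fin n)}
    (h : d⁻¹ a < d⁻¹ b) : len (Equiv.swap a b * d) = len d + 1 := by
  have hne : a < b := by rw [Fin.lt_def]; omega
  unfold len
  rw [← Finset.card_insert_of_notMem (a := (d⁻¹ a, d⁻¹ b))]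
  · congr 1
    ext ⟨x, y⟩
    simp only [Finset.mem_filter, Finset.mem_univ, true_and, Finset.mem_insert, Prod.mk.injEq,
      Equiv.Perm.eq_inv_iff_eq]
    rw [Equiv.Perm.mul_apply, Equiv.Perm.mul_apply]
    by_cases h₁ : d x = a ∧ d y = b
    · have hx : x = d⁻¹ a := by rw [Equiv.Perm.eq_inv_iff_eq, h₁.1]
      have hy : y = d⁻¹ b := by rw [Equiv.Perm.eq_inv_iff_eq, h₁.2]
      have hlt : x < y := by rwa [hx, hy]
      simp [h₁, hne, hlt]
    by_cases h₂ : d x = b ∧ d y = a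
    · have hx : x = d⁻¹ b := by rw [Equiv.Perm.eq_inv_iff_eq, h₂.1]
      have hy : y = d⁻¹ a := by rw [Equiv.Perm.eq_inv_iff_eq, h₂.2]
      have : ¬ x < y := by rw [hx, hy]; exact h.not_gt
      simp [this, h₁]
    · rw [swap_lt_swap_iff hab h₁ h₂]
      simp [h₁]
  · simpa using fun _ => hne.le

theorem len_one {n : ℕ} : len (1 : Equiv.Perm (Fin n)) = 0 := by
  rw [len, Finset.card_eq_zero, Finset.filter_eq_empty_iff]
  rintro ⟨x, y⟩ -
  simpa using fun h => h.le

theorem blockOf_mono (μ : List ℕ) : Monotone (blockOf μ) := by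
  intro k l hkl
  simp only [blockOf, ← List.countP_eq_length_filter]
  apply List.countP_mono_left
  intro j _ hj
  simp only [decide_eq_true_eq] at hj ⊢
  omega

theorem length_filter_range_lt (m t : ℕ) :
    ((List.range m).filter (fun j => j < t)).length = min m t := by
  induction m with
  | zero => simp
  | succ m ih =>
    rw [List.range_succ, List.filter_append, List.length_append, ih]
    by_cases h : m < t <;> simp [h] <;> omega

theorem blockOf_replicate_append {n m c k : ℕ} (hc : 0 < c) (hm : m * c ≤ n) (hk : k < n) :
    blockOf (List.replicate m c ++ [n - m * c]) k = min m (k / c) := by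
  rw [← length_filter_range_lt, blockOf, List.length_append, List.length_replicate,
    List.length_singleton, List.range_succ, List.filter_append, List.length_append]
  have h₁ : ¬ (List.take (m + 1) (List.replicate m c ++ [n - m * c])).sum ≤ k := by
    rw [List.take_of_length_le (by simp)]
    simp only [List.sum_append, List.sum_replicate, List.sum_singleton, smul_eq_mul]
    omega
  rw [List.filter_cons_of_neg (by simpa using h₁)]
  simp only [List.filter_nil, List.length_nil, add_zero]
  congr 1
  apply List.filter_congr
  intro j hj
  rw [List.mem_range] at hj
  rw [List.take_append_of_le_length (by simpa using hj), List.take_replicate,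
    min_eq_left (by omega), List.sum_replicate, smul_eq_mul]
  exact decide_eq_decide.mpr (Nat.le_div_iff_mul_le hc).symm

theorem swap_mem_youngSet {n : ℕ} {μ : List ℕ} {a b : Fin n}
    (h : blockOf μ a = blockOf μ b) : Equiv.swap a b ∈ youngSet n μ := by
  simp only [youngSet, Finset.mem_filter, Finset.mem_univ, true_and]
  intro x
  rw [Equiv.swap_apply_def]
  split_ifs <;> simp_all

/-- Minimal-length right coset representatives are the permutations whose inverse is
increasing on each block. -/
theorem mem_Dset_iff {n : ℕ} {μ : List ℕ} {d : Equiv.Perm (Fin n)} :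
    d ∈ Dset n μ ↔
      ∀ a b : Fin n, (b : ℕ) = a + 1 → blockOf μ a = blockOf μ b → d⁻¹ a < d⁻¹ b := by
  simp only [Dset, Finset.mem_filter, Finset.mem_univ, true_and]
  constructor
  · intro h a b hab hμ
    have hle := h _ (swap_mem_youngSet hμ)
    have hne : a ≠ b := by rw [Ne, Fin.ext_iff]; omega
    by_contra hlt
    have hlt' : d⁻¹ b < d⁻¹ a :=
      lt_of_le_of_ne (not_lt.mp hlt) fun he => hne (d⁻¹.injective he).symm
    have := len_swap_mul (d := Equiv.swap a b * d) hab (by simpa using hlt')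
    rw [Equiv.swap_mul_self_mul] at this
    omega
  · intro h u hu
    simp only [youngSet, Finset.mem_filter, Finset.mem_univ, true_and] at hu
    have hmono : ∀ k (a b : Fin n), (b : ℕ) = a + 1 + k → blockOf μ a = blockOf μ b →
        d⁻¹ a < d⁻¹ b := by
      intro k
      induction k with
      | zero => exact h
      | succ k ih =>
        intro a b hab hμ
        have hc : (a : ℕ) + 1 + k < n := by omega
        have h₁ := blockOf_mono μ (show (a : ℕ) ≤ a + 1 + k by omega)
        have h₂ := blockOf_mono μ (show (a : ℕ) + 1 + k ≤ b by omega)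
        have h₃ : blockOf μ a = blockOf μ (a + 1 + k) := by omega
        exact (ih a ⟨_, hc⟩ rfl h₃).trans
          (h ⟨_, hc⟩ b (by simp only [hab]; omega) (by simp only; omega))
    apply Finset.card_le_card
    intro ⟨x, y⟩
    simp only [Finset.mem_filter, Finset.mem_univ, true_and]
    rintro ⟨hxy, hd⟩
    refine ⟨hxy, ?_⟩
    have hle := blockOf_mono μ (show (d y : ℕ) ≤ d x from hd.le)
    have hne : blockOf μ (d y) ≠ blockOf μ (d x) := by
      intro he
      have hd' := Fin.lt_def.mp hd
      have := hmono (d x - d y - 1) (d y) (d x) (by omega) he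
      exact hxy.not_gt (by simpa using this)
    by_contra hn
    have := blockOf_mono μ (show (u (d x) : ℕ) ≤ u (d y) from not_lt.mp hn)
    rw [hu, hu] at this
    omega

open scoped Classical in
/-- The permutations whose inverse is increasing on the first `k` consecutive pairs of points and
on the points from position `2 * f` on (0-based). -/
noncomputable def pairIncreasing (n f k : ℕ) : Finset (Equiv.Perm (Fin n)) :=
  Finset.univ.filter fun d => ∀ a b : Fin n, (b : ℕ) = a + 1 →
    ((a : ℕ) % 2 = 0 ∧ (a : ℕ) < 2 * k ∨ 2 * f ≤ a) → d⁻¹ a < d⁻¹ b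

theorem mem_pairIncreasing {n f k : ℕ} {d : Equiv.Perm (Fin n)} :
    d ∈ pairIncreasing n f k ↔ ∀ a b : Fin n, (b : ℕ) = a + 1 →
      ((a : ℕ) % 2 = 0 ∧ (a : ℕ) < 2 * k ∨ 2 * f ≤ a) → d⁻¹ a < d⁻¹ b := by
  simp [pairIncreasing]

theorem Dset_replicate_one {n f : ℕ} (hfn : 2 * f ≤ n) :
    Dset n (List.replicate (2 * f) 1 ++ [n - 2 * f]) = pairIncreasing n f 0 := by
  ext d
  rw [mem_Dset_iff, mem_pairIncreasing]
  refine forall₃_congr fun a b hab => imp_congr_left ?_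
  have h := fun k => blockOf_replicate_append (n := n) (m := 2 * f) (c := 1) (k := k) one_pos
    (by omega)
  rw [mul_one] at h
  rw [h _ a.isLt, h _ b.isLt]
  omega

theorem Dset_replicate_two {n f : ℕ} (hfn : 2 * f ≤ n) :
    Dset n (List.replicate f 2 ++ [n - 2 * f]) = pairIncreasing n f f := by
  ext d
  rw [mem_Dset_iff, mem_pairIncreasing]
  refine forall₃_congr fun a b hab => imp_congr_left ?_
  have h := fun k => blockOf_replicate_append (n := n) (m := f) (c := 2) (k := k) two_pos
    (by omega)
  rw [mul_comm f 2] at h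
  rw [h _ a.isLt, h _ b.isLt]
  omega

theorem inv_lt_of_mem_pairIncreasing_succ {n f k : ℕ} {d : Equiv.Perm (Fin n)}
    (hd : d ∈ pairIncreasing n f (k + 1)) {x y : Fin n} (hx : (x : ℕ) = 2 * k)
    (hy : (y : ℕ) = 2 * k + 1) : d⁻¹ x < d⁻¹ y :=
  mem_pairIncreasing.mp hd x y (by omega) (Or.inl (by omega))

theorem swap_mul_mem_pairIncreasing {n f k : ℕ} (hkf : k < f) {d : Equiv.Perm (Fin n)}
    {x y : Fin n} (hx : (x : ℕ) = 2 * k) (hy : (y : ℕ) = 2 * k + 1)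
    (hd : d ∈ pairIncreasing n f k) : Equiv.swap x y * d ∈ pairIncreasing n f k := by
  rw [mem_pairIncreasing] at hd ⊢
  intro a b hab h
  have h₁ := hd a b hab h
  rwa [mul_inv_rev, Equiv.swap_inv, Equiv.Perm.mul_apply, Equiv.Perm.mul_apply,
    Equiv.swap_apply_of_ne_of_ne, Equiv.swap_apply_of_ne_of_ne] <;>
  · rw [Ne, Fin.ext_iff]
    omega

theorem mem_pairIncreasing_succ_iff {n f k : ℕ} {d : Equiv.Perm (Fin n)}
    {x y : Fin n} (hx : (x : ℕ) = 2 * k) (hy : (y : ℕ) = 2 * k + 1) :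
    d ∈ pairIncreasing n f (k + 1) ↔ d ∈ pairIncreasing n f k ∧ d⁻¹ x < d⁻¹ y := by
  refine ⟨fun hd => ⟨?_, inv_lt_of_mem_pairIncreasing_succ hd hx hy⟩, fun ⟨hd, hlt⟩ => ?_⟩
  · rw [mem_pairIncreasing] at hd ⊢
    exact fun a b hab h => hd a b hab (by omega)
  · rw [mem_pairIncreasing] at hd ⊢
    intro a b hab h
    by_cases ha : a = x
    · have hb : b = y := by rw [Fin.ext_iff] at ha ⊢; omega
      rwa [ha, hb]
    · rw [Fin.ext_iff] at ha
      exact hd a b hab (by omega)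

theorem sum_pairIncreasing {M : Type*} [AddCommMonoid M] {n f k : ℕ} (hkf : k < f)
    {x y : Fin n} (hx : (x : ℕ) = 2 * k) (hy : (y : ℕ) = 2 * k + 1)
    (g : Equiv.Perm (Fin n) → M) :
    ∑ d ∈ pairIncreasing n f k, g d =
      ∑ d ∈ pairIncreasing n f (k + 1), (g d + g (Equiv.swap x y * d)) := by
  classical
  have hxy : x ≠ y := by rw [Ne, Fin.ext_iff]; omega
  have hfilter : (pairIncreasing n f k).filter (fun d => d⁻¹ x < d⁻¹ y) =
      pairIncreasing n f (k + 1) := by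
    ext d
    rw [Finset.mem_filter, mem_pairIncreasing_succ_iff hx hy]
  rw [Finset.sum_add_distrib, ← Finset.sum_filter_add_sum_filter_not _
    (fun d : Equiv.Perm (Fin n) => d⁻¹ x < d⁻¹ y), hfilter]
  congr 1
  refine Finset.sum_nbij' (Equiv.swap x y * ·) (Equiv.swap x y * ·) ?_ ?_ ?_ ?_ ?_
  · intro d hd
    rw [Finset.mem_filter, not_lt] at hd
    rw [mem_pairIncreasing_succ_iff hx hy]
    refine ⟨swap_mul_mem_pairIncreasing hkf hx hy hd.1, ?_⟩
    simpa using lt_of_le_of_ne hd.2 fun he => hxy (d⁻¹.injective he).symm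
  · intro d hd
    rw [mem_pairIncreasing_succ_iff hx hy] at hd
    rw [Finset.mem_filter]
    exact ⟨swap_mul_mem_pairIncreasing hkf hx hy hd.1, by simpa using hd.2.le⟩
  · simp
  · simp
  · simp

section Algebra

variable {F : Type*} [Field F] {A : Type*} [Ring A] [Algebra F A] {n : ℕ} {q r : F}

theorem BMWData.commute_E_T (D : BMWData F A n q r) {i j : ℕ} (hi : 1 ≤ i) (hi' : i ≤ n - 1)
    (hj : 1 ≤ j) (hj' : j ≤ n - 1) (hij : i + 1 < j ∨ j + 1 < i) :
    Commute (D.E i) (D.T j) := by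
  have hT : Commute (D.T i) (D.T j) := D.T_comm i j hi hi' hj hj' hij
  have hTinv : Commute (D.Tinv i) (D.T j) :=
    hT.units_inv_left (u := ⟨D.T i, D.Tinv i, D.T_mul_Tinv i hi hi', D.Tinv_mul_T i hi hi'⟩)
  have hE : D.E i = 1 - (q - q⁻¹)⁻¹ • (D.T i - D.Tinv i) := by
    rw [D.skein i hi hi', inv_smul_smul₀ D.hqq, sub_sub_cancel]
  rw [hE]
  exact (Commute.one_left _).sub_left ((hT.sub_left hTinv).smul_left _)

theorem BMWData.Ehat_mul_T (D : BMWData F A n q r) {f k : ℕ} (hfn : 2 * f ≤ n) (hkf : k < f) :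
    Ehat D.E f * D.T (2 * k + 1) = r⁻¹ • Ehat D.E f := by
  induction f with
  | zero => omega
  | succ f ih =>
    have hE : Ehat D.E (f + 1) = Ehat D.E f * D.E (2 * f + 1) := by
      simp [Ehat, List.range_succ]
    rw [hE, mul_assoc]
    rcases Nat.lt_succ_iff_lt_or_eq.mp hkf with hk | rfl
    · rw [(D.commute_E_T (by omega) (by omega) (by omega) (by omega) (by omega)).eq, ← mul_assoc,
        ih (by omega) hk, smul_mul_assoc]
    · rw [D.ET _ (by omega) (by omega), mul_smul_comm]

theorem BMWData.Ehat_mul_hat_pairIncreasing (D : BMWData F A n q r) {f k : ℕ}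
    (hfn : 2 * f ≤ n) (hkf : k < f) :
    Ehat D.E f * hat q D.Tw (pairIncreasing n f k) =
      (1 + q * r⁻¹) • (Ehat D.E f * hat q D.Tw (pairIncreasing n f (k + 1))) := by
  obtain ⟨x, hx⟩ : ∃ x : Fin n, (x : ℕ) = 2 * k := ⟨⟨2 * k, by omega⟩, rfl⟩
  obtain ⟨y, hy⟩ : ∃ y : Fin n, (y : ℕ) = 2 * k + 1 := ⟨⟨2 * k + 1, by omega⟩, rfl⟩
  have hxy : (y : ℕ) = x + 1 := by omega
  have hs : sGen n (2 * k + 1) = Equiv.swap x y := by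
    rw [sGen, dif_pos ⟨by omega, by omega⟩]
    congr 1 <;> ext <;> simp [hx, hy]
  have hlen : len (Equiv.swap x y) = 1 := by
    have := len_swap_mul (d := 1) hxy (by rw [Fin.lt_def]; simp [hxy])
    rwa [mul_one, len_one] at this
  rw [hat, sum_pairIncreasing hkf hx hy, hat, Finset.mul_sum, Finset.mul_sum, Finset.smul_sum]
  refine Finset.sum_congr rfl fun d hd => ?_
  have hl := len_swap_mul hxy (inv_lt_of_mem_pairIncreasing_succ hd hx hy)
  rw [D.Tw_mul _ _ (by rw [hl, hlen, add_comm]), hl, ← hs, D.Tw_s _ (by omega) (by omega),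
    mul_add, mul_smul_comm, mul_smul_comm, ← mul_assoc, D.Ehat_mul_T hfn hkf, smul_mul_assoc,
    smul_smul, smul_smul, ← add_smul]
  congr 1
  ring

end Algebra

/-- For `0 ≤ 2f ≤ n`,
`Ê_f · D̂_{(1^{2f},n-2f)} = (1 + qr⁻¹)^f · Ê_f · D̂_{(2^f,n-2f)}`. -/
theorem statement13 {F : Type*} [Field F] {A : Type*} [Ring A] [Algebra F A]
    {n : ℕ} (hn : 1 ≤ n) {q r : F} (D : BMWData F A n q r)
    (f : ℕ) (hfn : 2 * f ≤ n) :
    Ehat D.E f * hat q D.Tw (Dset n (List.replicate (2 * f) 1 ++ [n - 2 * f])) =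
      (1 + q * r⁻¹) ^ f •
        (Ehat D.E f * hat q D.Tw (Dset n (List.replicate f 2 ++ [n - 2 * f]))) := by
  have h : ∀ k ≤ f, Ehat D.E f * hat q D.Tw (pairIncreasing n f 0) =
      (1 + q * r⁻¹) ^ k • (Ehat D.E f * hat q D.Tw (pairIncreasing n f k)) := by
    intro k
    induction k with
    | zero => simp
    | succ k ih =>
      intro hk
      rw [ih (by omega), D.Ehat_mul_hat_pairIncreasing hfn hk, smul_smul, pow_succ]
  rw [Dset_replicate_one hfn, Dset_replicate_two hfn]
  exact h f le_rfl

end BMWPaper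
end

section
/- Let 0 ≤ 2f ≤ n. Then in A one has Ê_f · D̂_{(2^f,n−2f)} = a_f · Ê_f · Ĥ_f, where (2^f,n−2f) denotes the composition with f parts equal to 2 followed by n−2f, Ĥ_f = Σ_{d∈H_f(n)} q^{ℓ(d)} T_d, and a_f ∈ F is defined by a_0 = 1 and a_i = a_{i−1}·(Σ_{k=0}^{i−1} q^{2k}) for i ≥ 1. -/
open Finset
open scoped Pointwise

namespace BMWPaper

section Algebra

variable {F : Type*} [Field F] {A : Type*} [Ring A] [Algebra F A]

section Permutations

variable {n : ℕ}

theorem sGen_inv (n i : ℕ) : (sGen n i)⁻¹ = sGen n i := by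
  unfold sGen
  split_ifs <;> simp

theorem pimg_sGen_mul (d : Equiv.Perm (Fin n)) {k : ℕ} (hk : 1 ≤ k) (hkn : k < n) {i : ℕ}
    (hi : 1 ≤ i) :
    pimg (sGen n k * d) i =
      pimg d (if i = k then k + 1 else if i = k + 1 then k else i) := by
  unfold pimg
  rw [mul_inv_rev, sGen_inv]
  unfold sGen
  by_cases h1 : i = k
  · subst h1
    simp [show i - 1 < n by omega, hk, hkn]
  · by_cases h2 : i = k + 1
    · subst h2
      simp [show k - 1 < n by omega, hk, hkn]
    · simp only [h1, h2, if_false, hk, hkn, and_self, dite_true, Equiv.Perm.mul_apply]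
      split_ifs with h
      · rw [Equiv.swap_apply_of_ne_of_ne] <;> simp [Fin.ext_iff] <;> omega
      · rfl

theorem pimg_injOn (d : Equiv.Perm (Fin n)) {i j : ℕ} (hi : 1 ≤ i) (hin : i ≤ n)
    (hj : 1 ≤ j) (hjn : j ≤ n) (h : pimg d i = pimg d j) : i = j := by
  unfold pimg at h
  rw [dif_pos (by omega), dif_pos (by omega)] at h
  have h' := d⁻¹.injective (Fin.ext (Nat.succ_injective h))
  simp only [Fin.mk.injEq] at h'
  omega

theorem pimg_val_add_one (d : Equiv.Perm (Fin n)) (a : Fin n) :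
    pimg d (a + 1) = (d⁻¹ a : Fin n) + 1 := by
  unfold pimg
  simp

theorem pimg_apply (d : Equiv.Perm (Fin n)) (a : Fin n) : pimg d (d a + 1) = a + 1 := by
  simp [pimg_val_add_one]

/-- Left multiplication by `s_k` adds one to the length when `(k)d < (k+1)d`. -/
theorem len_sGen_mul (d : Equiv.Perm (Fin n)) {k : ℕ} (hk : 1 ≤ k) (hkn : k < n)
    (h : pimg d k < pimg d (k + 1)) : len (sGen n k * d) = len d + 1 := by
  unfold pimg at h
  rw [dif_pos (by omega), dif_pos (by omega)] at h
  simp only [Nat.add_sub_cancel, Nat.add_lt_add_iff_right] at h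
  have hap : ∀ x, d (d⁻¹ x) = x := d.apply_symm_apply
  unfold len sGen
  rw [dif_pos ⟨hk, hkn⟩]
  set a : Fin n := ⟨k - 1, by omega⟩ with ha
  set b : Fin n := ⟨k, hkn⟩ with hb
  rw [← Finset.card_insert_of_notMem (a := (d⁻¹ a, d⁻¹ b))]
  · congr 1
    ext ⟨x, y⟩
    obtain ⟨x, rfl⟩ := d⁻¹.surjective x
    obtain ⟨y, rfl⟩ := d⁻¹.surjective y
    simp only [mem_filter, mem_univ, true_and, mem_insert, Prod.mk.injEq]
    simp only [Equiv.Perm.mul_apply, hap, EmbeddingLike.apply_eq_iff_eq]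
    have key : ∀ x : Fin n, ((Equiv.swap a b x : Fin n) : ℕ) =
        if (x : ℕ) = k - 1 then k else if (x : ℕ) = k then k - 1 else x := by
      intro x
      rw [Equiv.swap_apply_def]
      simp only [Fin.ext_iff, ha, hb]
      split_ifs <;> rfl
    have hxy : ∀ x y : Fin n, x < y ↔ (x : ℕ) < y := fun _ _ => Iff.rfl
    have e1 : (x : ℕ) = k - 1 → x = a := fun h => Fin.ext h
    have e2 : (x : ℕ) = k → x = b := fun h => Fin.ext h
    have e3 : (y : ℕ) = k - 1 → y = a := fun h => Fin.ext h
    have e4 : (y : ℕ) = k → y = b := fun h => Fin.ext h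
    have ha' : (a : ℕ) = k - 1 := rfl
    have hb' : (b : ℕ) = k := rfl
    have hlt : d⁻¹ a < d⁻¹ b := h
    rw [hxy (Equiv.swap a b y), key, key, hxy y]
    constructor
    · rintro ⟨h1, h2⟩
      by_cases hx : (x : ℕ) = k - 1
      · by_cases hy : (y : ℕ) = k
        · exact Or.inl ⟨e1 hx, e4 hy⟩
        · right; refine ⟨h1, ?_⟩; split_ifs at h2 <;> omega
      · right
        refine ⟨h1, ?_⟩
        by_cases hx2 : (x : ℕ) = k
        · by_cases hy : (y : ℕ) = k - 1
          · omega
          · split_ifs at h2 <;> omega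
        · split_ifs at h2 <;> omega
    · rintro (⟨rfl, rfl⟩ | ⟨h1, h2⟩)
      · refine ⟨hlt, ?_⟩
        split_ifs <;> omega
      · refine ⟨h1, ?_⟩
        by_cases hx : (x : ℕ) = k
        · by_cases hy : (y : ℕ) = k - 1
          · rw [e2 hx, e3 hy] at h1
            exact absurd (hlt.trans h1) (lt_irrefl _)
          · split_ifs <;> omega
        · split_ifs <;> omega
  · rw [mem_filter]
    simp only [mem_univ, true_and, hap, not_and, not_lt]
    intro _
    exact Fin.mk_le_mk.2 (by omega)

theorem blockOf_pairs {f k : ℕ} (hfn : 2 * f ≤ n) (hk : k < n) :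
    blockOf (List.replicate f 2 ++ [n - 2 * f]) k = min f (k / 2) := by
  unfold blockOf
  simp only [List.length_append, List.length_replicate, List.length_singleton]
  rw [List.range_succ, List.filter_append]
  have h1 : ∀ j ∈ List.range f, decide
      ((List.take (j + 1) (List.replicate f 2 ++ [n - 2 * f])).sum ≤ k) = decide (j < k / 2) := by
    intro j hj
    rw [List.mem_range] at hj
    rw [List.take_append_of_le_length (by simpa using hj)]
    simp only [List.take_replicate, List.sum_replicate, smul_eq_mul, decide_eq_decide]
    rw [min_eq_left (by omega)]
    omega
  rw [List.filter_congr h1]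
  have h2 : (List.take (f + 1) (List.replicate f 2 ++ [n - 2 * f])).sum = n := by
    rw [List.take_of_length_le (by simp)]
    simp
    omega
  have h3 : ∀ (a b : ℕ), ((List.range a).filter (fun j => decide (j < b))).length = min a b := by
    intro a b
    induction a with
    | zero => simp
    | succ a ih =>
      rw [List.range_succ, List.filter_append, List.length_append, ih]
      by_cases h : a < b
      · simp [h]; omega
      · simp [h]; omega
  simp [h2, h3, not_le.2 hk]

theorem mem_Dset_pairs {f : ℕ} (hfn : 2 * f ≤ n) (d : Equiv.Perm (Fin n)) :
    d ∈ Dset n (List.replicate f 2 ++ [n - 2 * f]) ↔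
      (∀ i, 1 ≤ i → i ≤ f → pimg d (2 * i - 1) < pimg d (2 * i)) ∧
        ∀ j, 2 * f + 1 ≤ j → j < n → pimg d j < pimg d (j + 1) := by
  simp only [Dset, youngSet, mem_filter, mem_univ, true_and]
  constructor
  · intro h
    have step : ∀ k, 1 ≤ k → k < n → min f ((k - 1) / 2) = min f (k / 2) →
        pimg d k < pimg d (k + 1) := by
      intro k hk hkn hb
      by_contra hlt
      have hne : pimg d k ≠ pimg d (k + 1) := fun e => by
        have := pimg_injOn d hk hkn.le (by omega) hkn e
        omega
      have hl := len_sGen_mul (sGen n k * d) hk hkn (by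
        rw [pimg_sGen_mul d hk hkn hk, pimg_sGen_mul d hk hkn (by omega)]
        simp
        omega)
      rw [← mul_assoc, eq_inv_iff_mul_eq_one.1 (sGen_inv n k).symm, one_mul] at hl
      have := h (sGen n k) (by
        intro a
        rw [blockOf_pairs hfn (Fin.is_lt _), blockOf_pairs hfn (Fin.is_lt _)]
        unfold sGen
        rw [dif_pos ⟨hk, hkn⟩, Equiv.swap_apply_def]
        split_ifs with h1 h2
        · rw [h1]; exact hb.symm
        · rw [h2]; exact hb
        · rfl)
      omega
    constructor
    · intro i h1 h2
      have := step (2 * i - 1) (by omega) (by omega) (by omega)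
      rwa [show 2 * i - 1 + 1 = 2 * i by omega] at this
    · intro j h1 h2
      exact step j (by omega) h2 (by omega)
  · rintro ⟨h1, h2⟩ u hu
    have tail : ∀ x y, 2 * f + 1 ≤ x → x < y → y ≤ n → pimg d x < pimg d y := by
      intro x y hx hxy
      induction y, hxy using Nat.le_induction with
      | base => exact fun hy => h2 x hx hy
      | succ y hy ih => exact fun hyn => (ih (by omega)).trans (h2 y (by omega) hyn)
    have mono : ∀ x y : Fin n, x < y → min f ((x : ℕ) / 2) = min f ((y : ℕ) / 2) →
        pimg d (x + 1) < pimg d (y + 1) := by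
      intro x y hxy hb
      have hxy' : (x : ℕ) < y := hxy
      by_cases hx : 2 * f ≤ (x : ℕ)
      · exact tail _ _ (by omega) (by omega) (by omega)
      · have := h1 (x / 2 + 1) (by omega) (by omega)
        rwa [show 2 * ((x : ℕ) / 2 + 1) - 1 = x + 1 by omega,
          show 2 * ((x : ℕ) / 2 + 1) = y + 1 by omega] at this
    refine Finset.card_le_card fun p hp => ?_
    rw [mem_filter] at hp ⊢
    simp only [mem_univ, true_and, Equiv.Perm.mul_apply] at hp ⊢
    refine ⟨hp.1, ?_⟩
    have hp' : ((d p.2 : Fin n) : ℕ) < d p.1 := hp.2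
    have hne : min f ((d p.2 : ℕ) / 2) ≠ min f ((d p.1 : ℕ) / 2) := fun e => by
      have := mono _ _ hp.2 e
      rw [pimg_apply, pimg_apply] at this
      have := Fin.lt_def.1 hp.1
      omega
    have b1 := hu (d p.1)
    have b2 := hu (d p.2)
    rw [blockOf_pairs hfn (Fin.is_lt _), blockOf_pairs hfn (Fin.is_lt _)] at b1 b2
    rw [Fin.lt_def]
    omega

end Permutations

section Relations

variable {F : Type*} [Field F] {A : Type*} [Ring A] [Algebra F A] {n : ℕ} {q r : F}

theorem skein_E (D : BMWData F A n q r) {i : ℕ} (h1 : 1 ≤ i) (h2 : i ≤ n - 1) :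
    D.E i = 1 - (q - q⁻¹)⁻¹ • (D.T i - D.Tinv i) := by
  rw [D.skein i h1 h2, smul_smul, inv_mul_cancel₀ D.hqq, one_smul, sub_sub_cancel]

/-- An element intertwining `T_i` and `T_j` intertwines `E_i` and `E_j`. -/
theorem semiconjBy_E (D : BMWData F A n q r) {x : A} {i j : ℕ} (hi1 : 1 ≤ i) (hi2 : i ≤ n - 1)
    (hj1 : 1 ≤ j) (hj2 : j ≤ n - 1) (h : x * D.T i = D.T j * x) : x * D.E i = D.E j * x := by
  have hinv : x * D.Tinv i = D.Tinv j * x := by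
    calc x * D.Tinv i = D.Tinv j * D.T j * x * D.Tinv i := by
          rw [D.Tinv_mul_T j hj1 hj2, one_mul]
      _ = D.Tinv j * x := by
          rw [mul_assoc _ _ x, ← h, ← mul_assoc, mul_assoc _ (D.T i), D.T_mul_Tinv i hi1 hi2,
            mul_one]
  rw [skein_E D hi1 hi2, skein_E D hj1 hj2]
  simp only [mul_sub, sub_mul, mul_one, one_mul, mul_smul_comm, smul_mul_assoc, h, hinv]

theorem E_comm (D : BMWData F A n q r) {i j : ℕ} (hi : 1 ≤ i) (hij : i + 1 < j)
    (hj : j ≤ n - 1) : D.E i * D.E j = D.E j * D.E i := by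
  have h1 : D.E i * D.T j = D.T j * D.E i :=
    (semiconjBy_E D hi (by omega) hi (by omega)
      (D.T_comm j i (by omega) hj hi (by omega) (Or.inr hij))).symm
  exact semiconjBy_E D (by omega) hj (by omega) hj h1

theorem Ehat_succ (E : ℕ → A) (f : ℕ) : Ehat E (f + 1) = Ehat E f * E (2 * f + 1) := by
  simp [Ehat, List.range_succ]

theorem Ehat_eq_mul (D : BMWData F A n q r) {f j : ℕ} (hfn : 2 * f ≤ n) (hj : j + 2 ≤ f) :
    ∃ Y : A, Ehat D.E f = Y * (D.E (2 * j + 1) * D.E (2 * j + 3)) := by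
  induction f, hj using Nat.le_induction with
  | base => exact ⟨Ehat D.E j, by rw [Ehat_succ, Ehat_succ, mul_assoc]; rfl⟩
  | succ f hf ih =>
    obtain ⟨Y, hY⟩ := ih (by omega)
    refine ⟨Y * D.E (2 * f + 1), ?_⟩
    rw [Ehat_succ, hY, mul_assoc, mul_assoc, mul_assoc,
      E_comm D (i := 2 * j + 3) (by omega) (by omega) (by omega),
      ← mul_assoc (D.E (2 * j + 1)), E_comm D (i := 2 * j + 1) (j := 2 * f + 1) (by omega)
        (by omega) (by omega), mul_assoc]

/-- The two orderings of a pair of neighbouring arcs contribute proportionally. -/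
theorem E_mul_E_mul_swapped (D : BMWData F A n q r) {i : ℕ} (hi : 1 ≤ i) (hin : i + 2 ≤ n - 1) :
    D.E i * D.E (i + 2) * (D.T (i + 1) * D.T i + q • (D.T (i + 1) * D.T i * D.T (i + 2)) +
        q ^ 2 • (D.T (i + 1) * D.T i * D.T (i + 2) * D.T (i + 1))) =
      D.E i * D.E (i + 2) * (1 + q • D.T (i + 1) + q ^ 2 • (D.T (i + 1) * D.T (i + 2))) := by
  set T₁ := D.T i
  set T₂ := D.T (i + 1)
  set T₃ := D.T (i + 2)
  set E₁ := D.E i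
  set E₂ := D.E (i + 1)
  set E₃ := D.E (i + 2)
  have hc : E₁ * E₃ = E₃ * E₁ := E_comm D hi (by omega) (by omega)
  have f1 : E₁ * T₂ * T₁ = E₁ * E₂ := by
    have := semiconjBy_E D (x := T₂ * T₁) (i := i + 1) (j := i) (by omega) (by omega) hi
      (by omega) (by rw [← D.braid i hi (by omega), mul_assoc])
    rw [mul_assoc, ← this, D.TTE₂ i hi (by omega)]
  have f2 : E₂ * T₃ * T₂ = E₂ * E₃ := by
    have := semiconjBy_E D (x := T₃ * T₂) (i := i + 2) (j := i + 1) (by omega) (by omega)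
      (by omega) (by omega) (by rw [← D.braid (i + 1) (by omega) (by omega), mul_assoc])
    rw [mul_assoc, ← this, D.TTE₂ (i + 1) (by omega) (by omega)]
  have f3 : E₃ * T₂ * T₃ = E₃ * E₂ := by
    have := semiconjBy_E D (x := T₂ * T₃) (i := i + 1) (j := i + 2) (by omega) (by omega)
      (by omega) (by omega)
      (by rw [D.braid (i + 1) (by omega) (by omega), mul_assoc])
    rw [mul_assoc, ← this, D.TTE₁ (i + 1) (by omega) (by omega)]
  have f4 : T₃ * T₃ = 1 + (q - q⁻¹) • (T₃ - r⁻¹ • E₃) := by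
    have h1 := congrArg (T₃ * ·) (D.skein (i + 2) (by omega) hin)
    simp only [mul_sub, mul_smul_comm, mul_one] at h1
    rw [D.T_mul_Tinv (i + 2) (by omega) hin, D.TE (i + 2) (by omega) hin] at h1
    rw [← h1]
    exact (add_sub_cancel 1 _).symm
  have g1 : E₁ * E₃ * T₂ * T₁ = E₁ * E₃ * T₂ * T₃ := by
    calc E₁ * E₃ * T₂ * T₁ = E₃ * (E₁ * T₂ * T₁) := by rw [hc]; simp only [mul_assoc]
      _ = E₁ * (E₃ * T₂ * T₃) := by rw [f1, f3, ← mul_assoc, ← mul_assoc, hc]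
      _ = E₁ * E₃ * T₂ * T₃ := by simp only [mul_assoc]
  have g2 : E₁ * E₃ * T₂ * E₃ = r • (E₁ * E₃) := by
    rw [mul_assoc E₁ E₃, mul_assoc E₁, D.ETE₂ (i + 1) (by omega) (by omega), mul_smul_comm]
  have g3 : E₁ * E₃ * T₂ * T₃ * T₃ = E₁ * E₃ * T₂ +
      (q - q⁻¹) • (E₁ * E₃ * T₂ * T₃ - E₁ * E₃) := by
    rw [mul_assoc _ T₃, f4]
    simp only [mul_add, mul_sub, mul_smul_comm, mul_one, g2, smul_smul, inv_mul_cancel₀ D.hr,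
      one_smul]
  have g4 : E₁ * E₃ * T₂ * T₃ * T₃ * T₂ = E₁ * E₃ := by
    calc E₁ * E₃ * T₂ * T₃ * T₃ * T₂ = E₁ * (E₃ * T₂ * T₃) * T₃ * T₂ := by
          simp only [mul_assoc]
      _ = E₁ * E₃ * (E₂ * T₃ * T₂) := by rw [f3]; simp only [mul_assoc]
      _ = E₁ * (E₃ * E₂ * E₃) := by rw [f2]; simp only [mul_assoc]
      _ = E₁ * E₃ := by rw [D.EEE₂ (i + 1) (by omega) (by omega)]
  simp only [mul_add, mul_smul_comm, mul_one, ← mul_assoc]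
  rw [g1, g4, g3, smul_add, smul_smul, smul_sub,
    show q * (q - q⁻¹) = q ^ 2 - 1 by rw [mul_sub, mul_inv_cancel₀ D.hq, sq]]
  simp only [sub_smul, one_smul]
  abel

end Relations

section Ordering

variable {n : ℕ}

/-- The elements `d` of `D_{(2^f,n-2f)}` such that for `i ≤ m` the value `(2i-1)d` is
smaller than all later values `(2j-1)d`. -/
noncomputable def sortedSet (n f m : ℕ) : Finset (Equiv.Perm (Fin n)) :=
  open scoped Classical in
  Finset.univ.filter (fun d =>
    (∀ i, 1 ≤ i → i ≤ f → pimg d (2 * i - 1) < pimg d (2 * i)) ∧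
    (∀ j, 2 * f + 1 ≤ j → j < n → pimg d j < pimg d (j + 1)) ∧
    ∀ i j, 1 ≤ i → i ≤ m → i < j → j ≤ f → pimg d (2 * i - 1) < pimg d (2 * j - 1))

/-- The elements `d` of `sortedSet n f m` whose `j`-th pair has the smallest first entry
among the pairs after the `m`-th one. -/
noncomputable def leastSet (n f m j : ℕ) : Finset (Equiv.Perm (Fin n)) :=
  open scoped Classical in
  (sortedSet n f m).filter (fun d =>
    ∀ l, m < l → l ≤ f → l ≠ j → pimg d (2 * j - 1) < pimg d (2 * l - 1))

theorem sortedSet_zero {f : ℕ} (hfn : 2 * f ≤ n) :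
    sortedSet n f 0 = Dset n (List.replicate f 2 ++ [n - 2 * f]) := by
  ext d
  rw [mem_Dset_pairs hfn]
  simp only [sortedSet, mem_filter, mem_univ, true_and]
  refine and_congr_right fun _ => and_iff_left ?_
  intro i j h1 h2
  omega

theorem sortedSet_self (n f : ℕ) : sortedSet n f f = Hset n f := by
  ext d
  simp only [sortedSet, Hset, mem_filter, mem_univ, true_and, mem_Icc]
  constructor
  · rintro ⟨h1, h2, h3⟩
    refine ⟨fun i hi => ?_, fun i hi => h1 i hi.1 hi.2, fun j hj => h2 j hj.1 (by omega)⟩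
    exact h3 i (i + 1) hi.1 (by omega) (by omega) (by omega)
  · rintro ⟨h1, h2, h3⟩
    refine ⟨fun i a b => h2 i ⟨a, b⟩, fun j a b => h3 j ⟨a, by omega⟩, fun i j hi _ hij => ?_⟩
    induction j, hij using Nat.le_induction with
    | base => exact fun hj => h1 i ⟨hi, by omega⟩
    | succ j hj ih => exact fun hjf => (ih (by omega)).trans (h1 j ⟨by omega, by omega⟩)

theorem leastSet_succ {f m : ℕ} : leastSet n f m (m + 1) = sortedSet n f (m + 1) := by
  ext d
  simp only [leastSet, sortedSet, mem_filter, mem_univ, true_and]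
  constructor
  · rintro ⟨⟨h1, h2, h3⟩, h4⟩
    refine ⟨h1, h2, fun i j hi him hij hj => ?_⟩
    rcases Nat.lt_or_ge m i with h | h
    · obtain rfl : i = m + 1 := by omega
      exact h4 j (by omega) hj (by omega)
    · exact h3 i j hi h hij hj
  · rintro ⟨h1, h2, h3⟩
    exact ⟨⟨h1, h2, fun i j hi him => h3 i j hi (by omega)⟩,
      fun l h4 h5 h6 => h3 (m + 1) l (by omega) le_rfl (by omega) h5⟩

/-- The defining conditions of `leastSet` not involving the order of the values in
`d` at the positions `2c+1, …, 2c+4`, the smallest of which is `v`. -/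
def OuterCond (f m c : ℕ) (d : Equiv.Perm (Fin n)) (v : ℕ) : Prop :=
  (∀ i, 1 ≤ i → i ≤ f → i ≠ c + 1 → i ≠ c + 2 → pimg d (2 * i - 1) < pimg d (2 * i)) ∧
  (∀ j, 2 * f + 1 ≤ j → j < n → pimg d j < pimg d (j + 1)) ∧
  (∀ i l, 1 ≤ i → i ≤ m → i < l → l ≤ f → l ≠ c + 1 → l ≠ c + 2 →
    pimg d (2 * i - 1) < pimg d (2 * l - 1)) ∧
  (∀ i, 1 ≤ i → i ≤ m → pimg d (2 * i - 1) < v) ∧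
  ∀ l, m < l → l ≤ f → l ≠ c + 1 → l ≠ c + 2 → v < pimg d (2 * l - 1)

theorem OuterCond.congr {f m c : ℕ} (hmc : m ≤ c) (hcf : c + 2 ≤ f) {d d' : Equiv.Perm (Fin n)}
    {v : ℕ} (h : ∀ i, 1 ≤ i → i < 2 * c + 1 ∨ 2 * c + 4 < i → pimg d' i = pimg d i)
    (hd : OuterCond f m c d v) : OuterCond f m c d' v := by
  obtain ⟨h1, h2, h3, h4, h5⟩ := hd
  refine ⟨fun i a1 a2 a3 a4 => ?_, fun j a1 a2 => ?_, fun i l a1 a2 a3 a4 a5 a6 => ?_,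
    fun i a1 a2 => ?_, fun l a1 a2 a3 a4 => ?_⟩
  · rw [h _ (by omega) (by omega), h _ (by omega) (by omega)]; exact h1 i a1 a2 a3 a4
  · rw [h _ (by omega) (by omega), h _ (by omega) (by omega)]; exact h2 j a1 a2
  · rw [h _ (by omega) (by omega), h _ (by omega) (by omega)]; exact h3 i l a1 a2 a3 a4 a5 a6
  · rw [h _ (by omega) (by omega)]; exact h4 i a1 a2
  · rw [h _ (by omega) (by omega)]; exact h5 l a1 a2 a3 a4

theorem mem_leastSet_left {f m c : ℕ} (hmc : m ≤ c) (hcf : c + 2 ≤ f)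
    (d : Equiv.Perm (Fin n)) :
    d ∈ leastSet n f m (c + 1) ↔ OuterCond f m c d (pimg d (2 * c + 1)) ∧
      pimg d (2 * c + 1) < pimg d (2 * c + 2) ∧ pimg d (2 * c + 3) < pimg d (2 * c + 4) ∧
      pimg d (2 * c + 1) < pimg d (2 * c + 3) := by
  simp only [leastSet, sortedSet, mem_filter, mem_univ, true_and]
  constructor
  · rintro ⟨⟨h1, h2, h3⟩, h4⟩
    exact ⟨⟨fun i a b _ _ => h1 i a b, h2, fun i l a1 a2 a3 a4 _ _ => h3 i l a1 a2 a3 a4,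
      fun i a b => h3 i (c + 1) a b (by omega) (by omega), fun l a b e _ => h4 l a b e⟩,
      h1 (c + 1) (by omega) (by omega), h1 (c + 2) (by omega) (by omega),
      h4 (c + 2) (by omega) (by omega) (by omega)⟩
  · rintro ⟨⟨h1, h2, h3, h4, h5⟩, h6, h7, h8⟩
    refine ⟨⟨fun i a b => ?_, h2, fun i l a1 a2 a3 a4 => ?_⟩, fun l a b e => ?_⟩
    · by_cases e1 : i = c + 1
      · subst e1; exact h6
      · by_cases e2 : i = c + 2
        · subst e2; exact h7
        · exact h1 i a b e1 e2
    · by_cases e1 : l = c + 1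
      · subst e1; exact h4 i a1 a2
      · by_cases e2 : l = c + 2
        · subst e2; exact (h4 i a1 a2).trans h8
        · exact h3 i l a1 a2 a3 a4 e1 e2
    · by_cases e2 : l = c + 2
      · subst e2; exact h8
      · exact h5 l a b e e2

theorem mem_leastSet_right {f m c : ℕ} (hmc : m ≤ c) (hcf : c + 2 ≤ f)
    (d : Equiv.Perm (Fin n)) :
    d ∈ leastSet n f m (c + 2) ↔ OuterCond f m c d (pimg d (2 * c + 3)) ∧
      pimg d (2 * c + 1) < pimg d (2 * c + 2) ∧ pimg d (2 * c + 3) < pimg d (2 * c + 4) ∧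
      pimg d (2 * c + 3) < pimg d (2 * c + 1) := by
  simp only [leastSet, sortedSet, mem_filter, mem_univ, true_and]
  constructor
  · rintro ⟨⟨h1, h2, h3⟩, h4⟩
    exact ⟨⟨fun i a b _ _ => h1 i a b, h2, fun i l a1 a2 a3 a4 _ _ => h3 i l a1 a2 a3 a4,
      fun i a b => h3 i (c + 2) a b (by omega) (by omega), fun l a b _ e => h4 l a b e⟩,
      h1 (c + 1) (by omega) (by omega), h1 (c + 2) (by omega) (by omega),
      h4 (c + 1) (by omega) (by omega) (by omega)⟩
  · rintro ⟨⟨h1, h2, h3, h4, h5⟩, h6, h7, h8⟩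
    refine ⟨⟨fun i a b => ?_, h2, fun i l a1 a2 a3 a4 => ?_⟩, fun l a b e => ?_⟩
    · by_cases e1 : i = c + 1
      · subst e1; exact h6
      · by_cases e2 : i = c + 2
        · subst e2; exact h7
        · exact h1 i a b e1 e2
    · by_cases e1 : l = c + 1
      · subst e1; exact (h4 i a1 a2).trans h8
      · by_cases e2 : l = c + 2
        · subst e2; exact h4 i a1 a2
        · exact h3 i l a1 a2 a3 a4 e1 e2
    · by_cases e2 : l = c + 1
      · subst e2; exact h8
      · exact h5 l a b e2 e

/-- The first entry of some pair after the `m`-th is the smallest. -/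
theorem sum_sortedSet {M : Type*} [AddCommMonoid M] {f m : ℕ} (hfn : 2 * f ≤ n) (hmf : m < f)
    (g : Equiv.Perm (Fin n) → M) :
    ∑ d ∈ sortedSet n f m, g d =
      ∑ j ∈ Finset.range (f - m), ∑ d ∈ leastSet n f m (m + 1 + j), g d := by
  classical
  rw [← Finset.sum_biUnion]
  · refine Finset.sum_congr ?_ fun _ _ => rfl
    ext d
    simp only [mem_biUnion, Finset.mem_range]
    constructor
    · intro hd
      obtain ⟨j, hj, hmin⟩ := Finset.exists_min_image (Finset.Ioc m f)
        (fun l => pimg d (2 * l - 1)) ⟨m + 1, by simp; omega⟩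
      rw [mem_Ioc] at hj
      refine ⟨j - (m + 1), by omega, ?_⟩
      rw [Nat.add_sub_cancel' (by omega)]
      refine mem_filter.2 ⟨hd, fun l h1 h2 h3 => lt_of_le_of_ne (hmin l (by simp; omega)) ?_⟩
      intro e
      have := pimg_injOn d (by omega) (by omega) (by omega) (by omega) e
      omega
    · rintro ⟨j, -, hd⟩
      exact (mem_filter.1 hd).1
  · intro i hi j hj hij
    simp only [Finset.coe_range, Set.mem_Iio] at hi hj
    refine Finset.disjoint_left.2 fun d h1 h2 => ?_
    have a1 := (mem_filter.1 h1).2 (m + 1 + j) (by omega) (by omega) (by omega)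
    have a2 := (mem_filter.1 h2).2 (m + 1 + i) (by omega) (by omega) (by omega)
    exact lt_asymm a1 a2

end Ordering

section Sums

variable {F : Type*} [Field F] {A : Type*} [Ring A] [Algebra F A] {n : ℕ} {q r : F}

theorem Tw_sGen_mul (D : BMWData F A n q r) (d : Equiv.Perm (Fin n)) {k : ℕ} (hk : 1 ≤ k)
    (hkn : k < n) (h : pimg d k < pimg d (k + 1)) : D.Tw (sGen n k * d) = D.T k * D.Tw d := by
  have h0 : len (1 : Equiv.Perm (Fin n)) = 0 := by
    unfold len
    rw [Finset.card_eq_zero, Finset.filter_eq_empty_iff]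
    rintro p - ⟨h1, h2⟩
    exact lt_asymm h1 h2
  have h1 : len (sGen n k) = 1 := by
    have := len_sGen_mul (1 : Equiv.Perm (Fin n)) hk hkn (by
      unfold pimg
      rw [dif_pos (by omega), dif_pos (by omega)]
      simp
      omega)
    rwa [mul_one, h0] at this
  rw [D.Tw_mul _ _ (by rw [len_sGen_mul d hk hkn h, h1, add_comm]), D.Tw_s k hk (by omega)]

/-- Moving the smallest pair one step to the right multiplies the sum by `q²`. -/
theorem sum_leastSet_succ (D : BMWData F A n q r) {f m c : ℕ} (hfn : 2 * f ≤ n) (hmc : m ≤ c)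
    (hcf : c + 2 ≤ f) :
    ∑ d ∈ leastSet n f m (c + 2), q ^ len d • (Ehat D.E f * D.Tw d) =
      q ^ 2 • ∑ d ∈ leastSet n f m (c + 1), q ^ len d • (Ehat D.E f * D.Tw d) := by
  classical
  set g : Equiv.Perm (Fin n) → A := fun d => q ^ len d • (Ehat D.E f * D.Tw d) with hg
  set s₁ := sGen n (2 * c + 1)
  set s₂ := sGen n (2 * c + 2)
  set s₃ := sGen n (2 * c + 3)
  have p₁ : ∀ (d : Equiv.Perm (Fin n)) (i : ℕ), 1 ≤ i → pimg (s₁ * d) i =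
      pimg d (if i = 2 * c + 1 then 2 * c + 2 else if i = 2 * c + 2 then 2 * c + 1 else i) :=
    fun d i hi => pimg_sGen_mul d (by omega) (by omega) hi
  have p₂ : ∀ (d : Equiv.Perm (Fin n)) (i : ℕ), 1 ≤ i → pimg (s₂ * d) i =
      pimg d (if i = 2 * c + 2 then 2 * c + 3 else if i = 2 * c + 3 then 2 * c + 2 else i) :=
    fun d i hi => pimg_sGen_mul d (by omega) (by omega) hi
  have p₃ : ∀ (d : Equiv.Perm (Fin n)) (i : ℕ), 1 ≤ i → pimg (s₃ * d) i =
      pimg d (if i = 2 * c + 3 then 2 * c + 4 else if i = 2 * c + 4 then 2 * c + 3 else i) :=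
    fun d i hi => pimg_sGen_mul d (by omega) (by omega) hi
  have o₁ : ∀ d v, OuterCond f m c (s₁ * d) v ↔ OuterCond f m c d v := fun d v =>
    ⟨.congr hmc hcf fun i hi h => by rw [p₁ d i hi, if_neg (by omega), if_neg (by omega)],
      .congr hmc hcf fun i hi h => by rw [p₁ d i hi, if_neg (by omega), if_neg (by omega)]⟩
  have o₂ : ∀ d v, OuterCond f m c (s₂ * d) v ↔ OuterCond f m c d v := fun d v =>
    ⟨.congr hmc hcf fun i hi h => by rw [p₂ d i hi, if_neg (by omega), if_neg (by omega)],
      .congr hmc hcf fun i hi h => by rw [p₂ d i hi, if_neg (by omega), if_neg (by omega)]⟩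
  have o₃ : ∀ d v, OuterCond f m c (s₃ * d) v ↔ OuterCond f m c d v := fun d v =>
    ⟨.congr hmc hcf fun i hi h => by rw [p₃ d i hi, if_neg (by omega), if_neg (by omega)],
      .congr hmc hcf fun i hi h => by rw [p₃ d i hi, if_neg (by omega), if_neg (by omega)]⟩
  set C : Finset (Equiv.Perm (Fin n)) := Finset.univ.filter (fun d =>
    OuterCond f m c d (pimg d (2 * c + 1)) ∧ pimg d (2 * c + 1) < pimg d (2 * c + 2) ∧
      pimg d (2 * c + 2) < pimg d (2 * c + 3) ∧ pimg d (2 * c + 3) < pimg d (2 * c + 4)) with hC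
  have ne : ∀ (d : Equiv.Perm (Fin n)) (i j : ℕ), i < j → j ≤ 4 → 1 ≤ i →
      pimg d (2 * c + i) ≠ pimg d (2 * c + j) := fun d i j h1 h2 h3 e => by
    have := pimg_injOn d (by omega) (by omega) (by omega) (by omega) e
    omega
  have left : ∑ d ∈ leastSet n f m (c + 1), g d =
      ∑ d ∈ C, (g d + (g (s₂ * d) + g (s₂ * s₃ * d))) := by
    rw [← Finset.sum_filter_add_sum_filter_not _
      (fun d => pimg d (2 * c + 2) < pimg d (2 * c + 3)),
      ← Finset.sum_filter_add_sum_filter_not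
        ((leastSet n f m (c + 1)).filter fun d => ¬ pimg d (2 * c + 2) < pimg d (2 * c + 3))
        (fun d => pimg d (2 * c + 2) < pimg d (2 * c + 4)),
      Finset.sum_add_distrib, Finset.sum_add_distrib]
    congr 1
    · refine Finset.sum_congr ?_ fun _ _ => rfl
      ext d
      simp only [hC, mem_filter, mem_univ, true_and, mem_leastSet_left hmc hcf]
      grind
    congr 1
    · refine (Finset.sum_equiv (Equiv.mulLeft s₂) (fun d => ?_) fun _ _ => rfl).symm
      have n₁ := ne d 1 2; have n₂ := ne d 1 3; have n₃ := ne d 1 4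
      have n₄ := ne d 2 3; have n₅ := ne d 2 4; have n₆ := ne d 3 4
      simp [hC, mem_leastSet_left hmc hcf, p₂, o₂]
      grind
    · refine (Finset.sum_equiv (Equiv.mulLeft (s₂ * s₃)) (fun d => ?_) fun _ _ => rfl).symm
      have n₁ := ne d 1 2; have n₂ := ne d 1 3; have n₃ := ne d 1 4
      have n₄ := ne d 2 3; have n₅ := ne d 2 4; have n₆ := ne d 3 4
      simp [hC, mem_leastSet_left hmc hcf, p₂, o₂, p₃, o₃]
      grind
  have right : ∑ d ∈ leastSet n f m (c + 2), g d =
      ∑ d ∈ C, (g (s₂ * s₁ * d) + (g (s₂ * s₁ * s₃ * d) + g (s₂ * s₁ * s₃ * s₂ * d))) := by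
    rw [← Finset.sum_filter_add_sum_filter_not _
      (fun d => pimg d (2 * c + 2) < pimg d (2 * c + 4)),
      ← Finset.sum_filter_add_sum_filter_not
        ((leastSet n f m (c + 2)).filter fun d => ¬ pimg d (2 * c + 2) < pimg d (2 * c + 4))
        (fun d => pimg d (2 * c + 1) < pimg d (2 * c + 4)),
      Finset.sum_add_distrib, Finset.sum_add_distrib]
    congr 1
    · refine (Finset.sum_equiv (Equiv.mulLeft (s₂ * s₁)) (fun d => ?_) fun _ _ => rfl).symm
      have n₁ := ne d 1 2; have n₂ := ne d 1 3; have n₃ := ne d 1 4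
      have n₄ := ne d 2 3; have n₅ := ne d 2 4; have n₆ := ne d 3 4
      simp [hC, mem_leastSet_right hmc hcf, p₂, o₂, p₁, o₁]
      grind
    congr 1
    · refine (Finset.sum_equiv (Equiv.mulLeft (s₂ * s₁ * s₃)) (fun d => ?_) fun _ _ => rfl).symm
      have n₁ := ne d 1 2; have n₂ := ne d 1 3; have n₃ := ne d 1 4
      have n₄ := ne d 2 3; have n₅ := ne d 2 4; have n₆ := ne d 3 4
      simp [hC, mem_leastSet_right hmc hcf, p₂, o₂, p₁, o₁, p₃, o₃, mul_assoc]
      grind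
    · refine (Finset.sum_equiv (Equiv.mulLeft (s₂ * s₁ * s₃ * s₂)) (fun d => ?_)
        fun _ _ => rfl).symm
      have n₁ := ne d 1 2; have n₂ := ne d 1 3; have n₃ := ne d 1 4
      have n₄ := ne d 2 3; have n₅ := ne d 2 4; have n₆ := ne d 3 4
      simp [hC, mem_leastSet_right hmc hcf, p₂, o₂, p₁, o₁, p₃, o₃, mul_assoc]
      grind
  have l₁ : ∀ d : Equiv.Perm (Fin n), pimg d (2 * c + 1) < pimg d (2 * c + 2) →
      len (s₁ * d) = len d + 1 ∧ D.Tw (s₁ * d) = D.T (2 * c + 1) * D.Tw d := fun d h =>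
    ⟨len_sGen_mul d (by omega) (by omega) h, Tw_sGen_mul D d (by omega) (by omega) h⟩
  have l₂ : ∀ d : Equiv.Perm (Fin n), pimg d (2 * c + 2) < pimg d (2 * c + 3) →
      len (s₂ * d) = len d + 1 ∧ D.Tw (s₂ * d) = D.T (2 * c + 2) * D.Tw d := fun d h =>
    ⟨len_sGen_mul d (by omega) (by omega) h, Tw_sGen_mul D d (by omega) (by omega) h⟩
  have l₃ : ∀ d : Equiv.Perm (Fin n), pimg d (2 * c + 3) < pimg d (2 * c + 4) →
      len (s₃ * d) = len d + 1 ∧ D.Tw (s₃ * d) = D.T (2 * c + 3) * D.Tw d := fun d h =>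
    ⟨len_sGen_mul d (by omega) (by omega) h, Tw_sGen_mul D d (by omega) (by omega) h⟩
  rw [left, right, Finset.smul_sum]
  refine Finset.sum_congr rfl fun d hd => ?_
  simp only [hC, mem_filter, mem_univ, true_and] at hd
  obtain ⟨-, a₁, a₂, a₃⟩ := hd
  obtain ⟨b₁, c₁⟩ := l₁ d a₁
  obtain ⟨b₂, c₂⟩ := l₂ d a₂
  obtain ⟨b₃, c₃⟩ := l₃ d a₃
  obtain ⟨b₂₃, c₂₃⟩ := l₂ (s₃ * d) (by simp [p₃]; omega)
  obtain ⟨b₂₁, c₂₁⟩ := l₂ (s₁ * d) (by simp [p₁]; omega)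
  obtain ⟨b₁₃, c₁₃⟩ := l₁ (s₃ * d) (by simp [p₃]; omega)
  obtain ⟨b₂₁₃, c₂₁₃⟩ := l₂ (s₁ * (s₃ * d)) (by simp [p₃, p₁]; omega)
  obtain ⟨b₃₂, c₃₂⟩ := l₃ (s₂ * d) (by simp [p₂]; omega)
  obtain ⟨b₁₃₂, c₁₃₂⟩ := l₁ (s₃ * (s₂ * d)) (by simp [p₃, p₂]; omega)
  obtain ⟨b₂₁₃₂, c₂₁₃₂⟩ := l₂ (s₁ * (s₃ * (s₂ * d))) (by simp [p₃, p₁, p₂]; omega)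
  obtain ⟨Y, hY⟩ := Ehat_eq_mul D hfn hcf
  have key := congrArg (fun x => q ^ (len d + 2) • (Y * x * D.Tw d))
    (E_mul_E_mul_swapped D (i := 2 * c + 1) (by omega) (by omega))
  simp only [hg, mul_assoc, b₁, b₂, b₃, b₂₃, b₂₁, b₁₃, b₂₁₃, b₃₂, b₁₃₂, b₂₁₃₂, c₁, c₂, c₃, c₂₃,
    c₂₁, c₁₃, c₂₁₃, c₃₂, c₁₃₂, c₂₁₃₂, hY]
  simp only [add_assoc, mul_assoc, mul_add, add_mul, smul_add, mul_smul_comm, smul_mul_assoc,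
    smul_smul, one_mul, ← pow_add, ← pow_succ, Nat.reduceAdd] at key ⊢
  convert key using 3 <;> ring_nf

theorem sum_leastSet_add (D : BMWData F A n q r) {f m : ℕ} (hfn : 2 * f ≤ n) (j : ℕ)
    (hj : m + 1 + j ≤ f) :
    ∑ d ∈ leastSet n f m (m + 1 + j), q ^ len d • (Ehat D.E f * D.Tw d) =
      q ^ (2 * j) • ∑ d ∈ sortedSet n f (m + 1), q ^ len d • (Ehat D.E f * D.Tw d) := by
  induction j with
  | zero => simp [leastSet_succ]
  | succ j ih =>
    rw [show m + 1 + (j + 1) = m + j + 2 by omega,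
      sum_leastSet_succ D hfn (by omega) (by omega), show m + j + 1 = m + 1 + j by omega,
      ih (by omega), smul_smul, ← pow_add]
    congr 2
    omega

theorem sum_sortedSet_sub (D : BMWData F A n q r) {f : ℕ} (hfn : 2 * f ≤ n) (t : ℕ)
    (ht : t ≤ f) :
    ∑ d ∈ sortedSet n f (f - t), q ^ len d • (Ehat D.E f * D.Tw d) =
      aseq q t • ∑ d ∈ sortedSet n f f, q ^ len d • (Ehat D.E f * D.Tw d) := by
  induction t with
  | zero => simp [aseq]
  | succ t ih =>
    rw [sum_sortedSet hfn (by omega), show f - (f - (t + 1)) = t + 1 by omega,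
      Finset.sum_congr rfl fun j hj => sum_leastSet_add D hfn j (by
        rw [Finset.mem_range] at hj; omega),
      ← Finset.sum_smul, show f - (t + 1) + 1 = f - t by omega, ih (by omega), smul_smul, aseq,
      mul_comm]

end Sums

end Algebra

/-- For `0 ≤ 2f ≤ n`, `Ê_f · D̂_{(2^f,n-2f)} = a_f · Ê_f · Ĥ_f`,
where `a_0 = 1` and `a_i = a_{i-1} · Σ_{k=0}^{i-1} q^{2k}`. -/
theorem statement14 {F : Type*} [Field F] {A : Type*} [Ring A] [Algebra F A]
    {n : ℕ} (hn : 1 ≤ n) {q r : F} (D : BMWData F A n q r)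
    (f : ℕ) (hfn : 2 * f ≤ n) :
    Ehat D.E f * hat q D.Tw (Dset n (List.replicate f 2 ++ [n - 2 * f])) =
      aseq q f • (Ehat D.E f * hat q D.Tw (Hset n f)) := by

  have h := sum_sortedSet_sub D hfn f le_rfl
  rw [Nat.sub_self, sortedSet_zero hfn, sortedSet_self] at h
  simpa only [hat, Finset.mul_sum, mul_smul_comm] using h

end BMWPaper
end
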